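/- Let f : [1,∞) → ℝ be piecewise continuous, bounded on compact intervals, and suppose f(x) ≥ 0 for all x ≥ x₀ (some x₀ > 1). Define F(s) = ∫_1^∞ f(x) x^{−s−1} dx, absolutely convergent for Re(s) > σ_a. If F extends analytically to a neighborhood of the real segment (σ₀, ∞), then the integral defining F converges absolutely for all s with Re(s) > σ₀ and F is analytic there. -/

import Mathlib

open MeasureTheory Complex

open ProbabilityTheory Filter Topology in
/-- Landau's theorem for moment generating functions of nonpositive functions. -/
theorem landau_mgf {Ω : Type*} {m : MeasurableSpace Ω} (μ : Measure Ω) (X : Ω → ℝ)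
    (hX : AEMeasurable X μ) (hX0 : ∀ᵐ ω ∂μ, X ω ≤ 0) (σa σ₀ : ℝ)
    (habs : ∀ σ : ℝ, σa < σ → σ ∈ integrableExpSet X μ)
    (U : Set ℂ) (G : ℂ → ℂ) (hU : IsOpen U) (hUr : ∀ σ : ℝ, σ₀ < σ → (σ : ℂ) ∈ U)
    (hG : DifferentiableOn ℂ G U)
    (hGe : ∀ s ∈ U, σa < s.re → G s = complexMGF X μ s) (t : ℝ) (ht : σ₀ < t) :
    t ∈ integrableExpSet X μ := by
  by_contra htS
  set S := integrableExpSet X μ with hS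
  have hup : ∀ a ∈ S, ∀ b, a ≤ b → b ∈ S := by
    intro a ha b hab
    have ha' : Integrable (fun ω ↦ Real.exp (a * X ω)) μ := ha
    change Integrable (fun ω ↦ Real.exp (b * X ω)) μ
    refine ha'.mono (by fun_prop) ?_
    filter_upwards [hX0] with ω hω
    simp only [Real.norm_eq_abs, Real.abs_exp]
    exact Real.exp_le_exp.2 (mul_le_mul_of_nonpos_right hab hω)
  have hlb : ∀ b ∈ S, t ≤ b := by
    intro b hb
    by_contra! h
    exact htS (hup b hb t h.le)
  have hne : S.Nonempty := ⟨σa + 1, habs _ (by linarith)⟩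
  set a := sInf S with ha
  have hta : t ≤ a := le_csInf hne hlb
  have hbd : BddBelow S := ⟨t, hlb⟩
  have hIoi : Set.Ioi a ⊆ S := by
    intro b hb
    obtain ⟨c, hc, hcb⟩ := exists_lt_of_csInf_lt hne hb
    exact hup c hc b hcb.le
  have hint : Set.Ioi a ⊆ interior S := interior_maximal hIoi isOpen_Ioi
  have hGan : ∀ r : ℝ, σ₀ < r → AnalyticAt ℂ G r := fun r hr =>
    hG.analyticAt (hU.mem_nhds (hUr r hr))
  have hMan : ∀ r : ℝ, a < r → AnalyticAt ℂ (complexMGF X μ) r := fun r hr =>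
    analyticAt_complexMGF (by simpa using hint hr)
  have hreal : ∀ (H : ℂ → ℂ) (r : ℝ), AnalyticAt ℂ H r →
      AnalyticAt ℝ (fun x : ℝ => H x) r := by
    intro H r h
    have h1 : AnalyticAt ℝ H (r : ℂ) := h.restrictScalars
    exact AnalyticAt.comp_of_eq (f := fun x : ℝ => (x : ℂ)) h1 (Complex.ofRealCLM.analyticAt r) rfl
  have heq : Set.EqOn (fun x : ℝ => G x) (fun x : ℝ => complexMGF X μ x) (Set.Ioi a) := by
    have hb : max a σa + 1 ∈ Set.Ioi a := by
      have := le_max_left a σa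
      simp only [Set.mem_Ioi]; linarith
    refine AnalyticOnNhd.eqOn_of_preconnected_of_eventuallyEq
      (𝕜 := ℝ) (z₀ := max a σa + 1) ?_ ?_ isPreconnected_Ioi hb ?_
    · intro r hr
      exact hreal _ _ (hGan r (by simp only [Set.mem_Ioi] at hr; linarith))
    · intro r hr
      exact hreal _ _ (hMan r hr)
    · have h1 : max a σa < max a σa + 1 := by linarith
      filter_upwards [Ioi_mem_nhds h1] with r hr
      simp only [Set.mem_Ioi, max_lt_iff] at hr
      exact hGe r (hUr r (by linarith)) (by simpa using hr.2)
  -- a ball about `a`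
  obtain ⟨ε, hε, hball⟩ := Metric.isOpen_iff.1 hU a (hUr a (by linarith))
  set c : ℝ := a + ε / 4 with hc
  have hca : a < c := by linarith
  have hcball : Metric.ball (c : ℂ) (3 * ε / 4) ⊆ U := by
    refine subset_trans (Metric.ball_subset_ball' ?_) hball
    rw [Complex.dist_eq, ← Complex.ofReal_sub, Complex.norm_real, Real.norm_eq_abs,
      abs_of_pos (by linarith)]
    linarith
  have hloc : G =ᶠ[𝓝 (c : ℂ)] complexMGF X μ := by
    refine ((hGan c (by linarith)).frequently_eq_iff_eventually_eq (hMan c hca)).1 ?_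
    have htend : Tendsto (fun x : ℝ => (x : ℂ)) (𝓝[≠] c) (𝓝[≠] (c : ℂ)) := by
      refine tendsto_nhdsWithin_of_tendsto_nhds_of_eventually_within _
        (Complex.continuous_ofReal.continuousAt.tendsto.mono_left nhdsWithin_le_nhds) ?_
      filter_upwards [self_mem_nhdsWithin] with x hx
      simpa using hx
    refine htend.frequently (Eventually.frequently ?_)
    filter_upwards [nhdsWithin_le_nhds (Ioi_mem_nhds hca)] with x hx
    exact heq hx
  -- Taylor expansion
  have hz : ((c - ε / 2 : ℝ) : ℂ) ∈ Metric.ball (c : ℂ) (3 * ε / 4) := by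
    rw [Metric.mem_ball, Complex.dist_eq, ← Complex.ofReal_sub, Complex.norm_real,
      Real.norm_eq_abs]
    rw [show c - ε / 2 - c = -(ε / 2) by ring, abs_neg, abs_of_pos (by linarith)]
    linarith
  have hsum := (Complex.hasSum_taylorSeries_on_ball (hG.mono hcball) hz).summable
  have hcint : c ∈ interior S := hint hca
  set T : ℕ → Ω → ℝ := fun n ω => (n.factorial : ℝ)⁻¹ * ((-(ε / 2) * X ω) ^ n * Real.exp (c * X ω))
    with hT
  have hTint : ∀ n, Integrable (T n) μ := by
    intro n
    have := ((integrable_pow_mul_exp_of_mem_interior_integrableExpSet hcint n).const_mul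
      ((-(ε / 2)) ^ n)).const_mul ((n.factorial : ℝ)⁻¹)
    refine this.congr (Eventually.of_forall fun ω => ?_)
    simp only [hT, mul_pow]; ring
  have hTnn : ∀ n, 0 ≤ᵐ[μ] T n := by
    intro n
    filter_upwards [hX0] with ω hω
    have : 0 ≤ -(ε / 2) * X ω := mul_nonneg_of_nonpos_of_nonpos (by linarith) hω
    simp only [hT, Pi.zero_apply]
    positivity
  have hsumR : Summable (fun n => ∫ ω, T n ω ∂μ) := by
    rw [← Complex.summable_ofReal]
    refine hsum.congr fun n => ?_
    rw [hloc.iteratedDeriv_eq n, iteratedDeriv_complexMGF (by simpa using hcint)]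
    rw [← integral_complex_ofReal, smul_eq_mul, smul_eq_mul, ← integral_const_mul,
      ← integral_const_mul]
    refine integral_congr_ae (Eventually.of_forall fun ω => ?_)
    simp only [hT]
    push_cast
    rw [mul_pow]
    ring_nf
  have hmem : c - ε / 2 ∈ S := by
    change Integrable (fun ω ↦ Real.exp ((c - ε / 2) * X ω)) μ
    refine ⟨by fun_prop, ?_⟩
    rw [hasFiniteIntegral_iff_ofReal (Eventually.of_forall fun ω => (Real.exp_pos _).le)]
    have h1 : ∫⁻ ω, ENNReal.ofReal (Real.exp ((c - ε / 2) * X ω)) ∂μ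
        = ∫⁻ ω, ∑' n, ENNReal.ofReal (T n ω) ∂μ := by
      refine lintegral_congr_ae ?_
      filter_upwards [ae_all_iff.2 hTnn] with ω hω
      have hs : HasSum (fun n => T n ω) (Real.exp ((c - ε / 2) * X ω)) := by
        have h2 := (NormedSpace.expSeries_div_hasSum_exp (-(ε / 2) * X ω)).mul_right
          (Real.exp (c * X ω))
        rw [← Real.exp_eq_exp_ℝ, ← Real.exp_add] at h2
        rw [show -(ε / 2) * X ω + c * X ω = (c - ε / 2) * X ω by ring] at h2
        refine h2.congr_fun fun n => ?_
        simp only [hT]; ring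
      rw [← hs.tsum_eq, ENNReal.ofReal_tsum_of_nonneg hω hs.summable]
    rw [h1, lintegral_tsum fun n => (hTint n).aestronglyMeasurable.aemeasurable.ennreal_ofReal]
    have h3 : ∀ n, ∫⁻ ω, ENNReal.ofReal (T n ω) ∂μ = ENNReal.ofReal (∫ ω, T n ω ∂μ) :=
      fun n => (ofReal_integral_eq_lintegral_ofReal (hTint n) (hTnn n)).symm
    simp_rw [h3]
    exact hsumR.tsum_ofReal_lt_top
  have := csInf_le hbd hmem
  linarith

/-- The measure with density `g x / x` on `[1, ∞)`. -/
noncomputable def landauMeasure (g : ℝ → ℝ) : Measure ℝ :=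
  (volume.restrict (Set.Ici (1 : ℝ))).withDensity (fun x => ENNReal.ofReal (g x * x⁻¹))

theorem landau_ae (g : ℝ → ℝ) : ∀ᵐ x ∂(landauMeasure g), -Real.log x ≤ 0 := by
  refine (withDensity_absolutelyContinuous _ _).ae_le ?_
  filter_upwards [ae_restrict_mem measurableSet_Ici] with x hx
  simpa using Real.log_nonneg hx

theorem landau_mem (g : ℝ → ℝ) (hg : AEMeasurable g (volume.restrict (Set.Ici (1 : ℝ))))
    (hg0 : ∀ x, 0 ≤ g x) (t : ℝ) :
    t ∈ ProbabilityTheory.integrableExpSet (fun x => -Real.log x) (landauMeasure g) ↔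
      IntegrableOn (fun x : ℝ => g x * x ^ (-t - 1)) (Set.Ici (1 : ℝ)) := by
  change Integrable _ _ ↔ _
  rw [landauMeasure, integrable_withDensity_iff_integrable_smul₀'
    (by fun_prop) (Filter.Eventually.of_forall fun x => ENNReal.ofReal_lt_top)]
  refine integrable_congr ?_
  filter_upwards [ae_restrict_mem measurableSet_Ici] with x hx
  have hx0 : (0 : ℝ) < x := lt_of_lt_of_le one_pos hx
  rw [ENNReal.toReal_ofReal (mul_nonneg (hg0 x) (inv_nonneg.2 hx0.le)), smul_eq_mul,
    sub_eq_add_neg, Real.rpow_add hx0, Real.rpow_neg_one, Real.rpow_def_of_pos hx0]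
  rw [show Real.log x * -t = t * -Real.log x by ring]
  ring

theorem landau_mgf_eq (g : ℝ → ℝ) (hg : AEMeasurable g (volume.restrict (Set.Ici (1 : ℝ))))
    (hg0 : ∀ x, 0 ≤ g x) (s : ℂ) :
    ProbabilityTheory.complexMGF (fun x => -Real.log x) (landauMeasure g) s =
      ∫ x in Set.Ici (1 : ℝ), (g x : ℂ) * (x : ℂ) ^ (-s - 1) := by
  rw [ProbabilityTheory.complexMGF, landauMeasure, integral_withDensity_eq_integral_toReal_smul₀
    (by fun_prop) (Filter.Eventually.of_forall fun x => ENNReal.ofReal_lt_top)]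
  refine integral_congr_ae ?_
  filter_upwards [ae_restrict_mem measurableSet_Ici] with x hx
  have hx0 : (0 : ℝ) < x := lt_of_lt_of_le one_pos hx
  have hxc : (x : ℂ) ≠ 0 := by exact_mod_cast hx0.ne'
  rw [ENNReal.toReal_ofReal (mul_nonneg (hg0 x) (inv_nonneg.2 hx0.le)), Complex.real_smul,
    sub_eq_add_neg, Complex.cpow_add _ _ hxc, Complex.cpow_neg_one, Complex.cpow_def_of_ne_zero hxc,
    ← Complex.ofReal_log hx0.le]
  push_cast
  rw [show (Real.log x : ℂ) * -s = s * -(Real.log x : ℂ) by ring]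
  ring

theorem landau_cint (g : ℝ → ℝ) (hg : AEMeasurable g (volume.restrict (Set.Ici (1 : ℝ))))
    (hg0 : ∀ x, 0 ≤ g x) (s : ℂ)
    (h : IntegrableOn (fun x : ℝ => g x * x ^ (-s.re - 1)) (Set.Ici (1 : ℝ))) :
    IntegrableOn (fun x : ℝ => (g x : ℂ) * (x : ℂ) ^ (-s - 1)) (Set.Ici (1 : ℝ)) := by
  refine Integrable.mono h ?_ ?_
  · refine AEMeasurable.aestronglyMeasurable ?_
    fun_prop
  · filter_upwards [ae_restrict_mem measurableSet_Ici] with x hx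
    have hx0 : (0 : ℝ) < x := lt_of_lt_of_le one_pos hx
    rw [norm_mul, norm_mul, Complex.norm_cpow_eq_rpow_re_of_pos hx0, Complex.norm_real,
      Real.norm_eq_abs (x ^ _), abs_of_pos (Real.rpow_pos_of_pos hx0 _)]
    simp

theorem stmt13 (f : ℝ → ℝ) (x₀ σa σ₀ : ℝ)
    (hx₀ : 1 < x₀)
    (hloc : ∀ R : ℝ, IntegrableOn f (Set.Icc 1 R))
    (hnn : ∀ x ≥ x₀, 0 ≤ f x)
    (habs : ∀ σ : ℝ, σa < σ →
      IntegrableOn (fun x : ℝ => |f x| * x ^ (-σ - 1)) (Set.Ici (1 : ℝ)))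
    (hext : ∃ (U : Set ℂ) (G : ℂ → ℂ), IsOpen U ∧
      (∀ σ : ℝ, σ₀ < σ → (σ : ℂ) ∈ U) ∧ DifferentiableOn ℂ G U ∧
      ∀ s ∈ U, σa < s.re →
        G s = ∫ x in Set.Ici (1 : ℝ), (f x : ℂ) * (x : ℂ) ^ (-s - 1)) :
    (∀ s : ℂ, σ₀ < s.re →
      IntegrableOn (fun x : ℝ => |f x| * x ^ (-s.re - 1)) (Set.Ici (1 : ℝ))) ∧
    DifferentiableOn ℂ
      (fun s : ℂ => ∫ x in Set.Ici (1 : ℝ), (f x : ℂ) * (x : ℂ) ^ (-s - 1))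
      {s : ℂ | σ₀ < s.re} := by
  obtain ⟨U, G, hU, hUr, hG, hGe⟩ := hext
  have hfm : AEMeasurable f (volume.restrict (Set.Ici (1 : ℝ))) := by
    have : Set.Ici (1 : ℝ) = ⋃ n : ℕ, Set.Icc 1 (n : ℝ) := by
      ext x
      simp only [Set.mem_Ici, Set.mem_iUnion, Set.mem_Icc, exists_and_left, iff_self_and]
      exact fun _ => exists_nat_ge x
    rw [this, aemeasurable_iUnion_iff]
    exact fun n => (hloc n).aestronglyMeasurable.aemeasurable
  set p : ℝ → ℝ := fun x => max (f x) 0 with hp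
  set q : ℝ → ℝ := fun x => max (-f x) 0 with hq
  have hpm : AEMeasurable p (volume.restrict (Set.Ici (1 : ℝ))) := hfm.max aemeasurable_const
  have hqm : AEMeasurable q (volume.restrict (Set.Ici (1 : ℝ))) := hfm.neg.max aemeasurable_const
  have hp0 : ∀ x, 0 ≤ p x := fun x => le_max_right _ _
  have hq0 : ∀ x, 0 ≤ q x := fun x => le_max_right _ _
  have habsf : ∀ x, |f x| = p x + q x := by
    intro x
    simp only [hp, hq]
    rcases le_total 0 (f x) with h | h
    · rw [abs_of_nonneg h, max_eq_left h, max_eq_right (by linarith)]; ring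
    · rw [abs_of_nonpos h, max_eq_right h, max_eq_left (by linarith)]; ring
  have hfpq : ∀ x, f x = p x - q x := by
    intro x
    simp only [hp, hq]
    rcases le_total 0 (f x) with h | h
    · rw [max_eq_left h, max_eq_right (by linarith)]; ring
    · rw [max_eq_right h, max_eq_left (by linarith)]; ring
  have hqint : ∀ t : ℝ, IntegrableOn (fun x : ℝ => q x * x ^ (-t - 1)) (Set.Ici (1 : ℝ)) := by
    intro t
    have hunion : Set.Ici (1 : ℝ) = Set.Icc 1 x₀ ∪ Set.Ici x₀ :=
      (Set.Icc_union_Ici_eq_Ici hx₀.le).symm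
    rw [hunion, integrableOn_union]
    constructor
    · have h1 : IntegrableOn q (Set.Icc 1 x₀) := (hloc x₀).neg.sup (integrable_zero _ _ _)
      refine h1.mul_continuousOn ?_ isCompact_Icc
      intro x hx
      exact (Real.continuousAt_rpow_const x _ (Or.inl (by linarith [hx.1]))).continuousWithinAt
    · refine (integrableOn_zero (ε' := ℝ)).congr_fun (fun x hx => ?_) measurableSet_Ici
      have : q x = 0 := max_eq_right (by linarith [hnn x hx])
      simp [this]
  set Y : ℝ → ℝ := fun x => -Real.log x with hY
  have hqS : ProbabilityTheory.integrableExpSet Y (landauMeasure q) = Set.univ :=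
    Set.eq_univ_of_forall fun t => (landau_mem q hqm hq0 t).2 (hqint t)
  have hqd : Differentiable ℂ (ProbabilityTheory.complexMGF Y (landauMeasure q)) := by
    intro z
    exact (ProbabilityTheory.hasDerivAt_complexMGF (by rw [hqS]; simp)).differentiableAt
  have hpabs : ∀ σ : ℝ, σa < σ →
      IntegrableOn (fun x : ℝ => p x * x ^ (-σ - 1)) (Set.Ici (1 : ℝ)) := by
    intro σ hσ
    refine ((habs σ hσ).sub (hqint σ)).congr (Filter.Eventually.of_forall fun x => ?_)
    simp only [Pi.sub_apply, habsf]; ring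
  have hsplit : ∀ s : ℂ, IntegrableOn (fun x : ℝ => p x * x ^ (-s.re - 1)) (Set.Ici (1 : ℝ)) →
      ∫ x in Set.Ici (1 : ℝ), (f x : ℂ) * (x : ℂ) ^ (-s - 1) =
        ProbabilityTheory.complexMGF Y (landauMeasure p) s -
        ProbabilityTheory.complexMGF Y (landauMeasure q) s := by
    intro s hs
    rw [landau_mgf_eq p hpm hp0, landau_mgf_eq q hqm hq0,
      ← integral_sub (landau_cint p hpm hp0 s hs) (landau_cint q hqm hq0 s (hqint _))]
    refine integral_congr_ae (Filter.Eventually.of_forall fun x => ?_)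
    simp only [hfpq x]
    push_cast
    ring
  have key : ∀ t : ℝ, σ₀ < t → t ∈ ProbabilityTheory.integrableExpSet Y (landauMeasure p) := by
    refine landau_mgf (landauMeasure p) Y (by fun_prop) (landau_ae p) σa σ₀
      (fun σ hσ => (landau_mem p hpm hp0 σ).2 (hpabs σ hσ)) U
      (fun s => G s + ProbabilityTheory.complexMGF Y (landauMeasure q) s) hU hUr
      (hG.add hqd.differentiableOn) ?_
    intro s hs hsa
    rw [hGe s hs hsa, hsplit s (hpabs _ hsa)]
    ring
  have keyp : ∀ t : ℝ, σ₀ < t →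
      IntegrableOn (fun x : ℝ => p x * x ^ (-t - 1)) (Set.Ici (1 : ℝ)) :=
    fun t ht => (landau_mem p hpm hp0 t).1 (key t ht)
  refine ⟨fun s hs => ?_, ?_⟩
  · refine ((keyp _ hs).add (hqint s.re)).congr (Filter.Eventually.of_forall fun x => ?_)
    simp only [Pi.add_apply, habsf]; ring
  · have hd : DifferentiableOn ℂ (fun s => ProbabilityTheory.complexMGF Y (landauMeasure p) s -
        ProbabilityTheory.complexMGF Y (landauMeasure q) s) {s : ℂ | σ₀ < s.re} := by
      refine DifferentiableOn.sub ?_ hqd.differentiableOn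
      refine ProbabilityTheory.differentiableOn_complexMGF.mono fun s hs => ?_
      exact interior_maximal (fun t ht => key t ht) isOpen_Ioi hs
    exact hd.congr fun s hs => hsplit s (keyp _ hs)
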